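/- Let A be a commutative ring and I an ideal of A such that A is Henselian with respect to I. Let τ be a unit of A, let a, b ∈ A with a − b a unit of A, and let M = [[p, q],[r, s]] be a 2×2 matrix over A all of whose entries are congruent modulo I to the corresponding entries of τ·[[a, −a·b],[1, −b]]. Then there exist α, α' ∈ A with α − a ∈ I and α' − b ∈ I such that r·α² + (s − p)·α − q = 0 and r·α'² + (s − p)·α' − q = 0; that is, (α : 1) and (α' : 1) are fixed points of the Möbius transformation z ↦ (p·z + q)/(r·z + s) determined by M. -/

import Mathlib

/-- In a Henselian ring, a simple root modulo `I` of a quadratic with unit leading coefficient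
lifts to a root. -/
theorem HenselianRing.exists_quadratic_root {A : Type*} [CommRing A] (I : Ideal A)
    [HenselianRing A I] {u v w c : A} (hu : IsUnit u) (hc : u * c ^ 2 + v * c + w ∈ I)
    (hd : IsUnit (Ideal.Quotient.mk I (2 * u * c + v))) :
    ∃ t : A, t - c ∈ I ∧ u * t ^ 2 + v * t + w = 0 := by
  obtain ⟨u, rfl⟩ := hu
  have hinv : (u : A) * (↑u⁻¹ : A) = 1 := u.mul_inv
  let f : Polynomial A :=
    .X ^ 2 + .C (↑u⁻¹ * v) * .X + .C (↑u⁻¹ * w)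
  have hf : f.Monic := by unfold f; monicity!
  have heval (t : A) : f.eval t = ↑u⁻¹ * (u * t ^ 2 + v * t + w) := by
    simp only [f, Polynomial.eval_add, Polynomial.eval_mul, Polynomial.eval_pow,
      Polynomial.eval_X, Polynomial.eval_C]
    linear_combination -t ^ 2 * hinv
  have hderiv : f.derivative.eval c = ↑u⁻¹ * (2 * u * c + v) := by
    simp [f]
    linear_combination -2 * c * hinv
  obtain ⟨t, ht, htc⟩ := HenselianRing.is_henselian (I := I) f hf c
    (heval c ▸ I.mul_mem_left _ hc)
    (by rw [hderiv, map_mul]; exact (u⁻¹.isUnit.map _).mul hd)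
  refine ⟨t, htc, ?_⟩
  rw [Polynomial.IsRoot, heval] at ht
  exact (Units.mul_right_eq_zero u⁻¹).mp ht

/-- An element congruent to a unit modulo an ideal inside the Jacobson radical is a unit. -/
theorem IsUnit.of_sub_mem_of_le_jacobson_bot {A : Type*} [CommRing A] {I : Ideal A}
    (hI : I ≤ Ideal.jacobson ⊥) {x y : A} (hy : IsUnit y) (hxy : x - y ∈ I) : IsUnit x := by
  obtain ⟨y, rfl⟩ := hy
  have h := y.isUnit.mul (Ideal.mem_jacobson_bot.mp (hI hxy) ↑y⁻¹)
  convert h using 1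
  linear_combination (-(x - y)) * y.mul_inv


/-- Let `A` be Henselian with respect to the ideal `I`, `τ` a unit, `a - b`
a unit, and `M = !![p, q; r, s]` congruent entrywise modulo `I` to `τ • !![a, -(a*b); 1, -b]`.
Then there exist fixed points `α ≡ a` and `α' ≡ b` modulo `I` of the Möbius transformation
of `M`, i.e. solutions of `r*t² + (s - p)*t - q = 0`. -/
theorem henselian_fixed_points
    (A : Type*) [CommRing A] (I : Ideal A) [HenselianRing A I]
    (τ a b p q r s : A) (hτ : IsUnit τ) (hab : IsUnit (a - b))
    (hM : ∀ i j : Fin 2, ((!![p, q; r, s] : Matrix (Fin 2) (Fin 2) A)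
        - τ • !![a, -(a * b); 1, -b]) i j ∈ I) :
    ∃ α α' : A,
      α - a ∈ I ∧ α' - b ∈ I ∧
      r * α ^ 2 + (s - p) * α - q = 0 ∧
      r * α' ^ 2 + (s - p) * α' - q = 0 := by
  have hp : p - τ * a ∈ I := by simpa using hM 0 0
  have hq : q - τ * -(a * b) ∈ I := by simpa using hM 0 1
  have hr : r - τ ∈ I := by simpa using hM 1 0
  have hs : s - τ * -b ∈ I := by simpa using hM 1 1
  have hru : IsUnit r :=
    hτ.of_sub_mem_of_le_jacobson_bot HenselianRing.jac hr
  simp only [← Ideal.Quotient.eq, map_mul, map_neg] at hp hq hr hs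
  have root (c : A) (hc : (c - a) * (c - b) = 0) (hd : IsUnit (2 * c - a - b)) :
      ∃ t : A, t - c ∈ I ∧ r * t ^ 2 + (s - p) * t - q = 0 := by
    simp only [sub_eq_add_neg _ q]
    refine HenselianRing.exists_quadratic_root I hru ?_ ?_
    · have hc' := congrArg (Ideal.Quotient.mk I) hc
      rw [← Ideal.Quotient.eq_zero_iff_mem]
      simp only [map_add, map_sub, map_mul, map_neg, map_pow, map_zero, hp, hq, hr, hs] at hc' ⊢
      linear_combination Ideal.Quotient.mk I τ * hc'
    · convert (hτ.mul hd).map (Ideal.Quotient.mk I) using 1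
      simp only [map_add, map_sub, map_mul, hp, hr, hs]
      ring
  obtain ⟨α, hα, hα₀⟩ := root a (by ring) (by convert hab using 1; ring)
  obtain ⟨α', hα', hα'₀⟩ := root b (by ring) (by convert hab.neg using 1; ring)
  exact ⟨α, α', hα, hα', hα₀, hα'₀⟩
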